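/- Let α be an irrational Diophantine number of type (c, τ), i.e. |α − p/q| ≥ c/q^{2+τ} for all integers p, q with q ≠ 0, and let m₀ be the smallest integer with m₀ > τ + 1. Then for every integer r ≥ 0 there exists a constant A_r > 0 such that for every C^{r+m₀} function ψ on the circle 𝕋 = ℝ/ℤ with ∫_𝕋 ψ(x) dx = 0, the cohomological equation φ(x + α) − φ(x) = ψ(x) has a solution φ of class C^r satisfying ‖φ‖_{C^r} ≤ A_r ‖ψ‖_{C^{r+m₀}}. -/

import Mathlib

open Function Real

/-- The `C^r` norm of a function: the max over `0 ≤ j ≤ r` of the sup norm of the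
`j`-th derivative. -/
noncomputable def Cnorm (r : ℕ) (f : ℝ → ℝ) : ℝ :=
  (Finset.range (r + 1)).sup' (Finset.nonempty_range_iff.mpr (Nat.succ_ne_zero r))
    (fun j => ⨆ x : ℝ, |iteratedDeriv j f x|)


lemma ce_dio {α c τ : ℝ}
    (hdio : ∀ p q : ℤ, q ≠ 0 → c / |(q : ℝ)| ^ ((2 : ℝ) + τ) ≤ |α - (p : ℝ) / (q : ℝ)|)
    (q p : ℤ) (hq : q ≠ 0) : c * |(q : ℝ)| ^ (-(1 + τ)) ≤ |q * α - p| := by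
  have hq' : (q : ℝ) ≠ 0 := by exact_mod_cast hq
  have hpos : 0 < |(q : ℝ)| := abs_pos.mpr hq'
  have h := mul_le_mul_of_nonneg_left (hdio p q hq) hpos.le
  rw [← abs_mul] at h
  have e1 : (q : ℝ) * (α - p / q) = q * α - p := by field_simp
  rw [e1] at h
  refine le_trans (le_of_eq ?_) h
  rw [show -(1 + τ) = 1 - (2 + τ) by ring, Real.rpow_sub hpos, Real.rpow_one]
  ring

lemma ce_sum {α c τ : ℝ} (hc : 0 < c) (hτ : 0 ≤ τ)
    (hdio : ∀ p q : ℤ, q ≠ 0 → c / |(q : ℝ)| ^ ((2 : ℝ) + τ) ≤ |α - (p : ℝ) / (q : ℝ)|)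
    (s : ℝ) (hs : 1 < s) :
    ∃ C : ℝ, 0 ≤ C ∧ ∀ N : ℕ, 1 ≤ N →
      ∑ n ∈ Finset.Icc 1 N, |(n : ℝ) * α - round ((n : ℝ) * α)|⁻¹ ≤ C * (N : ℝ) ^ ((1 + τ) * s) := by
  have hsum : Summable fun k : ℤ => |(k : ℝ)| ^ (-s) := Real.summable_abs_int_rpow hs
  refine ⟨(2 / c) ^ s * ∑' k : ℤ, |(k : ℝ)| ^ (-s),
    mul_nonneg (by positivity) (tsum_nonneg fun k => by positivity), fun N hN => ?_⟩
  have hN0 : (0 : ℝ) < N := by exact_mod_cast hN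
  set δ : ℝ := c * (N : ℝ) ^ (-(1 + τ)) with hδ
  have hδ0 : 0 < δ := by positivity
  set x : ℕ → ℝ := fun n => (n : ℝ) * α - round ((n : ℝ) * α) with hx
  set k : ℕ → ℤ := fun n => ⌊x n / δ⌋ with hk
  have hgap : ∀ q p : ℤ, q ≠ 0 → |(q : ℝ)| ≤ N → δ ≤ |q * α - p| := by
    intro q p hq hqN
    refine le_trans ?_ (ce_dio hdio q p hq)
    have : 0 < |(q : ℝ)| := abs_pos.mpr (by exact_mod_cast hq)
    exact mul_le_mul_of_nonneg_left
      (Real.rpow_le_rpow_of_nonpos this hqN (by linarith)) hc.le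
  have hx1 : ∀ n ∈ Finset.Icc 1 N, δ ≤ |x n| := by
    intro n hn
    rw [Finset.mem_Icc] at hn
    have := hgap (n : ℤ) (round ((n : ℝ) * α)) (by omega) (by
      rw [Int.cast_natCast, abs_of_nonneg (by positivity)]; exact_mod_cast hn.2)
    simpa [hx] using this
  have hinj : Set.InjOn k (Finset.Icc 1 N : Finset ℕ) := by
    intro a ha b hb hab
    by_contra hne
    simp only [Finset.coe_Icc, Set.mem_Icc] at ha hb
    have h1 := hgap ((a : ℤ) - b) (round ((a : ℝ) * α) - round ((b : ℝ) * α)) (by omega) (by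
      have h1 : (a : ℝ) ≤ N := by exact_mod_cast ha.2
      have h2 : (b : ℝ) ≤ N := by exact_mod_cast hb.2
      have h3 : (0 : ℝ) ≤ a := by positivity
      have h4 : (0 : ℝ) ≤ b := by positivity
      push_cast
      rw [abs_le]; constructor <;> linarith)
    have h2 : |x a / δ - x b / δ| < 1 := Int.abs_sub_lt_one_of_floor_eq_floor hab
    rw [← sub_div, abs_div, abs_of_pos hδ0, div_lt_one hδ0] at h2
    have e : x a - x b = (((a : ℤ) - b : ℤ) : ℝ) * α
        - ((round ((a : ℝ) * α) - round ((b : ℝ) * α) : ℤ) : ℝ) := by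
      simp only [hx]; push_cast; ring
    rw [e] at h2
    linarith
  have hterm : ∀ n ∈ Finset.Icc 1 N, |x n|⁻¹ ≤ (2 / δ) ^ s * |(k n : ℝ)| ^ (-s) := by
    intro n hn
    have h1 := hx1 n hn
    have hxp : 0 < |x n| := lt_of_lt_of_le hδ0 h1
    have hxle : |x n| ≤ 1 := (abs_sub_round _).trans (by norm_num)
    have hd : 1 ≤ |x n / δ| := by rw [abs_div, abs_of_pos hδ0, le_div_iff₀ hδ0]; linarith
    have hf1 := Int.floor_le (x n / δ)
    have hf2 := Int.lt_floor_add_one (x n / δ)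
    have hk0 : k n ≠ 0 := by
      intro h0
      have : ⌊x n / δ⌋ = 0 := h0
      rw [this] at hf1 hf2
      push_cast at hf1 hf2
      rw [abs_of_nonneg hf1] at hd
      linarith
    have hkp : 0 < |(k n : ℝ)| := abs_pos.mpr (by exact_mod_cast hk0)
    have hkle : |(k n : ℝ)| ≤ 2 / δ * |x n| := by
      have h2 : |(k n : ℝ)| ≤ |x n / δ| + 1 := by
        have h3 : |(k n : ℝ) - x n / δ| ≤ 1 := by
          rw [abs_le]; simp only [hk]; constructor <;> linarith
        have := abs_sub_abs_le_abs_sub (k n : ℝ) (x n / δ)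
        linarith
      have h4 : 2 / δ * |x n| = |x n / δ| + |x n / δ| := by
        rw [abs_div, abs_of_pos hδ0]; ring
      linarith
    calc |x n|⁻¹ = |x n| ^ (-1 : ℝ) := by rw [Real.rpow_neg_one]
      _ ≤ |x n| ^ (-s) := Real.rpow_le_rpow_of_exponent_ge hxp hxle (by linarith)
      _ = (2 / δ) ^ s * (2 / δ * |x n|) ^ (-s) := by
        rw [Real.mul_rpow (by positivity) hxp.le, ← mul_assoc, ← Real.rpow_add (by positivity)]
        simp
      _ ≤ _ := mul_le_mul_of_nonneg_left
        (Real.rpow_le_rpow_of_nonpos hkp hkle (by linarith)) (by positivity)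
  calc ∑ n ∈ Finset.Icc 1 N, |x n|⁻¹
      ≤ ∑ n ∈ Finset.Icc 1 N, (2 / δ) ^ s * |(k n : ℝ)| ^ (-s) := Finset.sum_le_sum hterm
    _ = (2 / δ) ^ s * ∑ j ∈ (Finset.Icc 1 N).image k, |(j : ℝ)| ^ (-s) := by
      rw [← Finset.mul_sum, Finset.sum_image hinj]
    _ ≤ (2 / δ) ^ s * ∑' j : ℤ, |(j : ℝ)| ^ (-s) :=
      mul_le_mul_of_nonneg_left (hsum.sum_le_tsum _ fun j _ => by positivity) (by positivity)
    _ = _ := by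
      have : 2 / δ = 2 / c * (N : ℝ) ^ (1 + τ) := by
        rw [hδ, Real.rpow_neg hN0.le]; field_simp
      rw [this, Real.mul_rpow (by positivity) (by positivity), ← Real.rpow_mul hN0.le]
      ring

lemma ce_summable_nat {α c τ : ℝ} (hc : 0 < c) (hτ : 0 ≤ τ)
    (hdio : ∀ p q : ℤ, q ≠ 0 → c / |(q : ℝ)| ^ ((2 : ℝ) + τ) ≤ |α - (p : ℝ) / (q : ℝ)|)
    (m : ℕ) (hm : τ + 1 < (m : ℝ)) :
    Summable fun n : ℕ => ((n : ℝ) ^ m)⁻¹ * |(n : ℝ) * α - round ((n : ℝ) * α)|⁻¹ := by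
  obtain ⟨s, hs1, hs2⟩ : ∃ s : ℝ, 1 < s ∧ (1 + τ) * s < m := by
    have h1 : 1 < m / (1 + τ) := by rw [lt_div_iff₀ (by linarith)]; linarith
    obtain ⟨s, h2, h3⟩ := exists_between h1
    refine ⟨s, h2, ?_⟩
    rw [lt_div_iff₀ (by linarith)] at h3
    linarith
  obtain ⟨C, hC, hb⟩ := ce_sum hc hτ hdio s hs1
  have hL : LSeriesSummable (fun n : ℕ => ((|(n : ℝ) * α - round ((n : ℝ) * α)|⁻¹ : ℝ) : ℂ))
      (m : ℂ) := by
    refine LSeriesSummable_of_sum_norm_bigO (r := (1 + τ) * s) ?_ (by positivity) (by simpa using hs2)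
    refine Asymptotics.IsBigO.of_bound C ?_
    filter_upwards [Filter.eventually_ge_atTop 1] with N hN
    rw [Real.norm_of_nonneg (by positivity), Real.norm_of_nonneg (by positivity)]
    refine le_trans (le_of_eq ?_) (hb N hN)
    refine Finset.sum_congr rfl fun n _ => ?_
    rw [Complex.norm_real, Real.norm_of_nonneg (by positivity)]
  refine hL.norm.congr fun n => ?_
  rcases eq_or_ne n 0 with rfl | hn
  · simp
  · rw [LSeries.term_of_ne_zero hn, Complex.cpow_natCast, norm_div, Complex.norm_real,
      Real.norm_of_nonneg (by positivity), norm_pow, Complex.norm_natCast]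
    ring

lemma ce_summable_int {α c τ : ℝ} (hc : 0 < c) (hτ : 0 ≤ τ)
    (hdio : ∀ p q : ℤ, q ≠ 0 → c / |(q : ℝ)| ^ ((2 : ℝ) + τ) ≤ |α - (p : ℝ) / (q : ℝ)|)
    (m : ℕ) (hm : τ + 1 < (m : ℝ)) :
    Summable fun n : ℤ => (|(n : ℝ)| ^ m)⁻¹ * |(n : ℝ) * α - round ((n : ℝ) * α)|⁻¹ := by
  have h := ce_summable_nat hc hτ hdio m hm
  have hr : ∀ y : ℝ, |(-y) - round (-y)| = |y - round y| := by
    intro y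
    apply le_antisymm
    · refine (round_le (-y) (-round y)).trans (le_of_eq ?_)
      rw [← abs_neg]; push_cast; congr 1; ring
    · refine (round_le y (-round (-y))).trans (le_of_eq ?_)
      rw [← abs_neg]; push_cast; congr 1; ring
  refine Summable.of_nat_of_neg ?_ ?_
  · refine h.congr fun n => ?_
    simp
  · refine h.congr fun n => ?_
    push_cast
    rw [neg_mul, hr, abs_neg, Nat.abs_cast]

/-- The exponential `e(n x)`. -/
noncomputable def ceE (n : ℤ) (x : ℝ) : ℂ := Complex.exp (2 * π * Complex.I * n * x)

/-- Fourier coefficient. -/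
noncomputable def ceC (f : ℝ → ℝ) (n : ℤ) : ℂ := ∫ x in (0:ℝ)..1, ceE (-n) x * (f x : ℂ)

lemma ceE_norm (n : ℤ) (x : ℝ) : ‖ceE n x‖ = 1 := by
  have : (2 * π * Complex.I * n * x : ℂ) = ((2 * π * n * x : ℝ) : ℂ) * Complex.I := by
    push_cast; ring
  rw [ceE, this, Complex.norm_exp_ofReal_mul_I]

lemma ceE_add (n : ℤ) (x y : ℝ) : ceE n (x + y) = ceE n x * ceE n y := by
  rw [ceE, ceE, ceE, ← Complex.exp_add]; push_cast; congr 1; ring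

lemma ceE_int (n : ℤ) (k : ℤ) : ceE n k = 1 := by
  rw [ceE, Complex.exp_eq_one_iff]
  exact ⟨n * k, by push_cast; ring⟩

lemma ceE_one (n : ℤ) : ceE n 1 = 1 := by simpa using ceE_int n 1

lemma ceE_zero (n : ℤ) : ceE n 0 = 1 := by simp [ceE]

lemma ceE_hasDerivAt (n : ℤ) (x : ℝ) :
    HasDerivAt (ceE n) (2 * π * Complex.I * n * ceE n x) x := by
  have h : HasDerivAt (fun y : ℂ => Complex.exp (2 * π * Complex.I * n * y))
      (2 * π * Complex.I * n * Complex.exp (2 * π * Complex.I * n * x)) (x : ℂ) := by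
    have := ((hasDerivAt_id (x : ℂ)).const_mul (2 * π * Complex.I * n : ℂ)).cexp
    simp only [id, mul_one] at this
    exact this.congr_deriv (mul_comm _ _)
  exact h.comp_ofReal

lemma ceE_contDiff (n : ℤ) (N : WithTop ℕ∞) : ContDiff ℝ N (ceE n) := by
  unfold ceE
  have : ContDiff ℝ N (fun x : ℝ => (x : ℂ)) := Complex.ofRealCLM.contDiff
  exact (contDiff_const.mul this).cexp

lemma ceE_continuous (n : ℤ) : Continuous (ceE n) := (ceE_contDiff n 0).continuous

lemma ceE_iter (n : ℤ) (k : ℕ) (x : ℝ) :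
    iteratedDeriv k (ceE n) x = (2 * π * Complex.I * n) ^ k * ceE n x := by
  induction k generalizing x with
  | zero => simp
  | succ k ih =>
    rw [iteratedDeriv_succ, funext ih, ((ceE_hasDerivAt n x).const_mul _).deriv]
    ring

lemma ce_norm_coef (n : ℤ) : ‖(2 * π * Complex.I * n : ℂ)‖ = 2 * π * |(n : ℝ)| := by
  simp [abs_of_pos Real.pi_pos]

lemma ceC_deriv {f : ℝ → ℝ} (hf : ContDiff ℝ 1 f) (hp : Periodic f 1) (n : ℤ) :
    ceC (deriv f) n = 2 * π * Complex.I * n * ceC f n := by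
  have hfd : ∀ x, HasDerivAt f (deriv f x) x := fun x =>
    (hf.differentiable one_ne_zero x).hasDerivAt
  have hc' : Continuous (deriv f) := hf.continuous_deriv le_rfl
  have h := intervalIntegral.integral_mul_deriv_eq_deriv_mul (a := 0) (b := 1)
    (u := ceE (-n)) (v := fun x => (f x : ℂ)) (u' := fun x => 2 * π * Complex.I * (-n : ℤ) * ceE (-n) x)
    (v' := fun x => ((deriv f x : ℝ) : ℂ))
    (fun x _ => ceE_hasDerivAt (-n) x) (fun x _ => (hfd x).ofReal_comp)
    ((continuous_const.mul (ceE_continuous _)).intervalIntegrable _ _)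
    ((Complex.continuous_ofReal.comp hc').intervalIntegrable _ _)
  have h01 : f 1 = f 0 := by simpa using hp 0
  unfold ceC
  rw [h, ceE_one, ceE_zero, h01]
  simp_rw [mul_assoc (2 * (π : ℂ) * Complex.I * ((-n : ℤ) : ℂ))]
  rw [intervalIntegral.integral_const_mul]
  push_cast; ring

lemma ce_periodic_deriv {f : ℝ → ℝ} (hp : Periodic f 1) : Periodic (deriv f) 1 := by
  intro x
  have : (fun y => f (y + 1)) = f := funext hp
  rw [← deriv_comp_add_const, this]

lemma ceC_iter (k : ℕ) : ∀ {f : ℝ → ℝ}, ContDiff ℝ (k : ℕ∞) f → Periodic f 1 → ∀ n : ℤ,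
    ceC (iteratedDeriv k f) n = (2 * π * Complex.I * n) ^ k * ceC f n := by
  induction k with
  | zero => intro f _ _ n; simp
  | succ k ih =>
    intro f hf hp n
    have hf' : ContDiff ℝ (k : ℕ∞) (deriv f) := by
      have : ContDiff ℝ ((k : WithTop ℕ∞) + 1) f := by exact_mod_cast hf
      exact_mod_cast (contDiff_succ_iff_deriv.mp this).2.2
    rw [iteratedDeriv_succ', ih hf' (ce_periodic_deriv hp),
      ceC_deriv (hf.of_le (by exact_mod_cast Nat.le_add_left 1 k)) hp]
    ring

lemma ce_periodic_iter {f : ℝ → ℝ} (hp : Periodic f 1) (k : ℕ) :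
    Periodic (iteratedDeriv k f) 1 := by
  induction k with
  | zero => simpa using hp
  | succ k ih => rw [iteratedDeriv_succ]; exact ce_periodic_deriv ih

lemma ceC_bound {f : ℝ → ℝ} {M : ℝ} (hM : ∀ x, |f x| ≤ M) (n : ℤ) : ‖ceC f n‖ ≤ M := by
  have := intervalIntegral.norm_integral_le_of_norm_le_const (a := 0) (b := 1) (C := M)
    (f := fun x => ceE (-n) x * (f x : ℂ)) (fun x _ => by
      rw [norm_mul, ceE_norm, one_mul, Complex.norm_real]; exact hM x)
  simpa [ceC] using this

lemma ce_hasSum {f : ℝ → ℝ} (hf : Continuous f) (hp : Periodic f 1) (hs : Summable (ceC f)) (x : ℝ) :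
    HasSum (fun n => ceC f n * ceE n x) (f x : ℂ) := by
  have hpc : Periodic (fun x => (f x : ℂ)) 1 := fun x => by simp [hp x]
  have hcont : Continuous (hpc.lift : AddCircle (1:ℝ) → ℂ) :=
    continuous_quot_lift _ (Complex.continuous_ofReal.comp hf)
  let F : C(AddCircle (1:ℝ), ℂ) := ⟨hpc.lift, hcont⟩
  have hF : ∀ n, fourierCoeff F n = ceC f n := by
    intro n
    rw [fourierCoeff_eq_intervalIntegral _ _ 0]
    simp only [div_one, one_smul, zero_add, ceC]
    refine intervalIntegral.integral_congr fun y _ => ?_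
    simp only [fourier_coe_apply, smul_eq_mul, ceE, Complex.ofReal_one, div_one]
    rfl
  have h := has_pointwise_sum_fourier_series_of_summable (f := F)
    (by rw [funext hF]; exact hs) (x : AddCircle (1:ℝ))
  have hval : F (x : AddCircle (1:ℝ)) = (f x : ℂ) := rfl
  rw [hval] at h
  convert h using 2 with n
  rw [hF, fourier_coe_apply, smul_eq_mul, ceE, Complex.ofReal_one, div_one]

lemma ceE_sub_one (n : ℤ) (α : ℝ) :
    4 * |(n : ℝ) * α - round ((n : ℝ) * α)| ≤ ‖ceE n α - 1‖ := by
  set y : ℝ := (n : ℝ) * α - round ((n : ℝ) * α) with hy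
  have hyl : |y| ≤ 1 / 2 := abs_sub_round _
  have e : ceE n α = Complex.exp (Complex.I * ((2 * π * y : ℝ) : ℂ)) := by
    rw [ceE, Complex.exp_eq_exp_iff_exists_int]
    refine ⟨round ((n : ℝ) * α), ?_⟩
    rw [hy]; push_cast; ring
  rw [e, Complex.norm_exp_I_mul_ofReal_sub_one, norm_mul, Real.norm_eq_abs, Real.norm_eq_abs,
    abs_two, show 2 * π * y / 2 = π * y by ring]
  have h := Real.mul_abs_le_abs_sin (x := π * y) (by
    rw [abs_mul, abs_of_pos Real.pi_pos]; nlinarith [Real.pi_pos])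
  rw [abs_mul, abs_of_pos Real.pi_pos] at h
  have : 2 / π * (π * |y|) = 2 * |y| := by field_simp
  linarith

lemma ce_main (α : ℝ) (hα : Irrational α) (m r : ℕ) (ψ : ℝ → ℝ)
    (hS : Summable fun n : ℤ => (|(n : ℝ)| ^ m)⁻¹ * |(n : ℝ) * α - round ((n : ℝ) * α)|⁻¹)
    (hψ : ContDiff ℝ ((r + m : ℕ) : ℕ∞) ψ) (hp : Periodic ψ 1)
    (h0 : (∫ x in (0:ℝ)..1, ψ x) = 0) (M : ℝ) (hM : ∀ x, |iteratedDeriv (r + m) ψ x| ≤ M) :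
    ∃ φ : ℝ → ℝ, ContDiff ℝ (r : ℕ∞) φ ∧ Periodic φ 1 ∧ (∀ x, φ (x + α) - φ x = ψ x) ∧
      ∀ j ≤ r, ∀ x, |iteratedDeriv j φ x| ≤ M *
        ∑' n : ℤ, (|(n : ℝ)| ^ m)⁻¹ * |(n : ℝ) * α - round ((n : ℝ) * α)|⁻¹ := by
  set S : ℤ → ℝ := fun n => (|(n : ℝ)| ^ m)⁻¹ * |(n : ℝ) * α - round ((n : ℝ) * α)|⁻¹ with hSdef
  have hM0 : 0 ≤ M := (abs_nonneg _).trans (hM 0)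
  have hC0 : ceC ψ 0 = 0 := by
    have : ceC ψ 0 = ((∫ x in (0:ℝ)..1, ψ x : ℝ) : ℂ) := by
      rw [ceC, ← intervalIntegral.integral_ofReal]
      refine intervalIntegral.integral_congr fun y _ => ?_
      simp [ceE]
    rw [this, h0]; simp
  have hy0 : ∀ n : ℤ, n ≠ 0 → 0 < |(n : ℝ) * α - round ((n : ℝ) * α)| := by
    intro n hn
    rw [abs_pos, sub_ne_zero]
    intro h
    exact (hα.intCast_mul hn).ne_int _ h
  have hE0 : ∀ n : ℤ, n ≠ 0 → ceE n α - 1 ≠ 0 := by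
    intro n hn
    rw [← norm_pos_iff]
    exact lt_of_lt_of_le (mul_pos four_pos (hy0 n hn)) (ceE_sub_one n α)
  set d : ℤ → ℂ := fun n => ceC ψ n / (ceE n α - 1) with hd
  have hbound : ∀ j ≤ r, ∀ n : ℤ, ‖d n‖ * (2 * π * |(n : ℝ)|) ^ j ≤ M * S n := by
    intro j hj n
    rcases eq_or_ne n 0 with rfl | hn
    · simp only [hd, hC0, zero_div, norm_zero, zero_mul]
      exact mul_nonneg hM0 (by simp only [hSdef]; positivity)
    have hn1 : 1 ≤ |(n : ℝ)| := by exact_mod_cast Int.one_le_abs hn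
    set t : ℝ := 2 * π * |(n : ℝ)| with ht
    have hpi := Real.pi_gt_three
    have htn : |(n : ℝ)| ≤ t := by nlinarith
    have ht1 : 1 ≤ t := hn1.trans htn
    have htp : 0 < t := by linarith
    have hc1 : t ^ (r + m) * ‖ceC ψ n‖ ≤ M := by
      have := ceC_bound hM n
      rwa [ceC_iter (r + m) hψ hp, norm_mul, norm_pow, ce_norm_coef] at this
    have hyn := hy0 n hn
    have hEn := ceE_sub_one n α
    set y := |(n : ℝ) * α - round ((n : ℝ) * α)| with hy
    have hden : y ≤ ‖ceE n α - 1‖ := by linarith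
    have hnp : 0 < |(n : ℝ)| := by linarith
    calc ‖d n‖ * t ^ j ≤ ‖d n‖ * t ^ r :=
          mul_le_mul_of_nonneg_left (pow_le_pow_right₀ ht1 hj) (norm_nonneg _)
      _ = (t ^ (r + m) * ‖ceC ψ n‖) * ((t ^ m)⁻¹ * ‖ceE n α - 1‖⁻¹) := by
          simp only [hd, norm_div]; rw [pow_add]; field_simp
      _ ≤ M * S n := by
          refine mul_le_mul hc1 ?_ (by positivity) hM0
          simp only [hSdef]
          gcongr
  have hdS : ∀ n, ‖d n‖ ≤ M * S n := fun n => by simpa using hbound 0 (Nat.zero_le _) n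
  have hdsum : Summable fun n => ‖d n‖ :=
    Summable.of_nonneg_of_le (fun _ => norm_nonneg _) hdS (hS.mul_left M)
  have hdE : ∀ n, d n * (ceE n α - 1) = ceC ψ n := by
    intro n
    rcases eq_or_ne n 0 with rfl | hn
    · simp [hd, hC0]
    · exact div_mul_cancel₀ _ (hE0 n hn)
  have hCsum : Summable (ceC ψ) := by
    refine Summable.of_norm_bounded (hdsum.mul_left 2) fun n => ?_
    rw [← hdE n, norm_mul, mul_comm]
    refine mul_le_mul_of_nonneg_right ?_ (norm_nonneg _)
    refine (norm_sub_le _ _).trans ?_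
    rw [ceE_norm]; norm_num
  have hsumx : ∀ x, Summable fun n => d n * ceE n x := fun x =>
    Summable.of_norm (by simpa [norm_mul, ceE_norm] using hdsum)
  set f : ℤ → ℝ → ℝ := fun n x => Complex.reCLM (d n * ceE n x) with hf
  have hcd : ∀ n (N : WithTop ℕ∞), ContDiff ℝ N (fun x => d n * ceE n x) := fun n N =>
    contDiff_const.mul (ceE_contDiff n N)
  have hfc : ∀ n, ContDiff ℝ ((r : ℕ∞) : WithTop ℕ∞) (f n) := fun n =>
    Complex.reCLM.contDiff.comp (hcd n _)
  have hfb : ∀ (k : ℕ) (n : ℤ) (x : ℝ), (k : ℕ∞) ≤ (r : ℕ∞) →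
      ‖iteratedFDeriv ℝ k (f n) x‖ ≤ M * S n := by
    intro k n x hk
    have hk' : k ≤ r := by exact_mod_cast hk
    have h1 := Complex.reCLM.norm_iteratedFDeriv_comp_left (x := x) (n := k)
      (N := (k : WithTop ℕ∞)) (hcd n k).contDiffAt le_rfl
    rw [Complex.reCLM_norm, one_mul, norm_iteratedFDeriv_eq_norm_iteratedDeriv (f := fun x => d n * ceE n x),
      iteratedDeriv_const_mul_field, ceE_iter, norm_mul, norm_mul, norm_pow, ce_norm_coef, ceE_norm,
      mul_one] at h1
    exact h1.trans (hbound k hk' n)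
  have hvs : ∀ k : ℕ, (k : ℕ∞) ≤ (r : ℕ∞) → Summable fun n => M * S n := fun _ _ => hS.mul_left M
  refine ⟨fun x => ∑' n, f n x, ?_, ?_, ?_, ?_⟩
  · exact contDiff_tsum (v := fun _ n => M * S n) hfc hvs hfb
  · intro x
    simp only [hf, ceE_add, ceE_one, mul_one]
  · intro x
    have h1 := (hsumx (x + α)).hasSum.sub (hsumx x).hasSum
    have h2 : HasSum (fun n => d n * ceE n (x + α) - d n * ceE n x) (ψ x : ℂ) := by
      have := ce_hasSum hψ.continuous hp hCsum x
      convert this using 2 with n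
      rw [← hdE n, ceE_add]; ring
    have h3 := congrArg Complex.re (h1.unique h2)
    rw [Complex.sub_re, Complex.ofReal_re] at h3
    rw [← h3]
    congr 1
    · exact (Complex.reCLM.map_tsum (hsumx (x + α))).symm
    · exact (Complex.reCLM.map_tsum (hsumx x)).symm
  · intro j hj x
    have hj' : (j : ℕ∞) ≤ (r : ℕ∞) := by exact_mod_cast hj
    rw [← Real.norm_eq_abs, ← norm_iteratedFDeriv_eq_norm_iteratedDeriv,
      iteratedFDeriv_tsum (v := fun _ n => M * S n) hfc hvs hfb hj', ← tsum_mul_left]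
    exact tsum_of_norm_bounded (hS.mul_left M).hasSum fun n => hfb j n x hj'

/-- Solution of the cohomological equation over a Diophantine rotation, with tame
estimates: loss of `m₀` derivatives, where `m₀` is the smallest integer `> τ + 1`. -/
theorem cohomological_equation_diophantine
    (α : ℝ) (hα : Irrational α) (c τ : ℝ) (hc : 0 < c) (hτ : 0 ≤ τ)
    (hdio : ∀ p q : ℤ, q ≠ 0 → c / |(q : ℝ)| ^ ((2 : ℝ) + τ) ≤ |α - (p : ℝ) / (q : ℝ)|)
    (m₀ : ℕ) (hm₀ : τ + 1 < (m₀ : ℝ)) (hm₀min : ∀ m : ℕ, τ + 1 < (m : ℝ) → m₀ ≤ m)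
    (r : ℕ) :
    ∃ A : ℝ, 0 < A ∧ ∀ ψ : ℝ → ℝ, ContDiff ℝ ((r + m₀ : ℕ) : ℕ∞) ψ →
      Function.Periodic ψ 1 → (∫ x in (0:ℝ)..1, ψ x) = 0 →
      ∃ φ : ℝ → ℝ, ContDiff ℝ (r : ℕ∞) φ ∧ Function.Periodic φ 1 ∧
        (∀ x, φ (x + α) - φ x = ψ x) ∧ Cnorm r φ ≤ A * Cnorm (r + m₀) ψ := by
  have hS := ce_summable_int hc hτ hdio m₀ hm₀
  set B : ℝ := ∑' n : ℤ, (|(n : ℝ)| ^ m₀)⁻¹ * |(n : ℝ) * α - round ((n : ℝ) * α)|⁻¹ with hB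
  have hB0 : 0 ≤ B := tsum_nonneg fun n => by positivity
  refine ⟨B + 1, by linarith, fun ψ hψ hp h0 => ?_⟩
  have hcont : Continuous (iteratedDeriv (r + m₀) ψ) :=
    hψ.continuous_iteratedDeriv (r + m₀) (by exact_mod_cast le_rfl)
  have hbdd : BddAbove (Set.range fun x => |iteratedDeriv (r + m₀) ψ x|) := by
    obtain ⟨K, hK⟩ := ((ce_periodic_iter hp (r + m₀)).isBounded_of_continuous
      one_ne_zero hcont).exists_norm_le
    refine ⟨K, ?_⟩
    rintro _ ⟨x, rfl⟩
    exact hK _ ⟨x, rfl⟩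
  have hM : ∀ x, |iteratedDeriv (r + m₀) ψ x| ≤ Cnorm (r + m₀) ψ := fun x =>
    (le_ciSup hbdd x).trans (Finset.le_sup' (fun j => ⨆ x : ℝ, |iteratedDeriv j ψ x|)
      (Finset.self_mem_range_succ (r + m₀)))
  have hM0 : 0 ≤ Cnorm (r + m₀) ψ := (abs_nonneg _).trans (hM 0)
  obtain ⟨φ, h1, h2, h3, h4⟩ := ce_main α hα m₀ r ψ hS hψ hp h0 _ hM
  refine ⟨φ, h1, h2, h3, ?_⟩
  refine Finset.sup'_le _ _ fun j hj => ?_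
  rw [Finset.mem_range] at hj
  refine ciSup_le fun x => (h4 j (by omega) x).trans ?_
  rw [mul_comm]
  exact mul_le_mul_of_nonneg_right (by linarith) hM0
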